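/- arXiv:2105.11633 — 6 statements merged into one kernel-verified Lean document; each statement's English description precedes it below -/
import Mathlib

section
/- Suppose there exists a simple graph G with two longest paths P and Q such that |V(P) \ V(Q)| = |V(Q) \ V(P)| = 1, |V(P) ∩ V(Q)| = ℓ, and the subgraph of G induced on V(G) \ (V(P) ∩ V(Q)) is connected. Then there exists a simple graph G₁ on exactly ℓ + 2 vertices with two longest paths P₁ and Q₁ such that |V(P₁) \ V(Q₁)| = |V(Q₁) \ V(P₁)| = 1, |V(P₁) ∩ V(Q₁)| = ℓ, V(G₁) = V(P₁) ∪ V(Q₁), and the subgraph of G₁ induced on V(G₁) \ (V(P₁) ∩ V(Q₁)) is connected. -/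
open SimpleGraph

/-- `P` is a longest path in the simple graph `G`: it is a path, and every path in `G`
has length at most the length of `P`. -/
def IsLongestPath {V : Type*} (G : SimpleGraph V) {u v : V} (P : G.Walk u v) : Prop :=
  P.IsPath ∧ ∀ {a b : V} (Q : G.Walk a b), Q.IsPath → Q.length ≤ P.length

namespace SimpleGraph.Walk

variable {V W : Type*}

/-- Two paths that meet only in their common end vertex concatenate to a path. -/
lemma IsPath.append_of_forall_mem_eq {G : SimpleGraph V} {u v w : V} {p : G.Walk u v}
    {q : G.Walk v w} (hp : p.IsPath) (hq : q.IsPath)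
    (h : ∀ z ∈ p.support, z ∈ q.support → z = v) : (p.append q).IsPath := by
  have hq' := hq.support_nodup
  rw [← cons_tail_support, List.nodup_cons] at hq'
  rw [isPath_def, support_append, List.nodup_append]
  refine ⟨hp.support_nodup, hq'.2, ?_⟩
  rintro z hzp _ hzq rfl
  obtain rfl := h z hzp (List.mem_of_mem_tail hzq)
  exact hq'.1 hzq

/-- A walk contained in the range of `f` lifts to the graph pulled back along `f`. -/
lemma exists_comap_support_map_eq {H : SimpleGraph V} (f : W → V) {u v : V} (p : H.Walk u v)
    (hp : ∀ z ∈ p.support, z ∈ Set.range f) :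
    ∃ (a b : W) (q : (H.comap f).Walk a b), f a = u ∧ q.support.map f = p.support := by
  induction p with
  | @nil u =>
    obtain ⟨a, rfl⟩ := hp u (by simp)
    exact ⟨a, a, nil, rfl, by simp⟩
  | @cons u v w h p ih =>
    obtain ⟨a, rfl⟩ := hp u (by simp)
    obtain ⟨c, b, q, rfl, hq⟩ := ih fun z hz => hp z (by simp [hz])
    exact ⟨a, b, cons (show (H.comap f).Adj a c from h) q, rfl, by simp [hq]⟩

/-- A walk in `G ⊔ edge x y` that does not use the edge `s(x, y)` is a walk in `G`. -/
lemma edges_subset_of_notMem_edges_sup_edge {G : SimpleGraph V} {x y a b : V}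
    (R : (G ⊔ edge x y).Walk a b) (h : s(x, y) ∉ R.edges) : ∀ e ∈ R.edges, e ∈ G.edgeSet := by
  intro e he
  have he' := R.edges_subset_edgeSet he
  rw [edgeSet_sup] at he'
  rcases he' with he' | he'
  · exact he'
  · induction e with | _ u v =>
    rcases ((edge_adj ..).1 he').1 with ⟨rfl, rfl⟩ | ⟨rfl, rfl⟩
    · exact absurd he h
    · exact absurd (Sym2.eq_swap ▸ he) h

/-- In a path using the extra edge `s(x, y)`, that edge can be replaced by a path of `G`
that meets the given path only in `x` and `y`. -/
lemma IsPath.exists_isPath_of_mem_edges_sup_edge {G : SimpleGraph V} {x y : V}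
    {T : G.Walk x y} (hT : T.IsPath) {a b : V} {R : (G ⊔ edge x y).Walk a b} (hR : R.IsPath)
    (hTR : ∀ z ∈ R.support, z ∈ T.support → z = x ∨ z = y) (he : s(x, y) ∈ R.edges) :
    ∃ R' : G.Walk a b, R'.IsPath ∧ R.length ≤ R'.length ∧
      ∀ z ∈ R'.support, z ∈ R.support ∨ z ∈ T.support := by
  induction R with
  | nil => simp at he
  | @cons a c b h p ih =>
    rw [cons_isPath_iff] at hR
    by_cases hac : s(x, y) = s(a, c)
    · have hp : s(x, y) ∉ p.edges := fun h' => hR.2 (p.fst_mem_support_of_mem_edges (hac ▸ h'))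
      have hpG := p.edges_subset_of_notMem_edges_sup_edge hp
      have key : ∀ T' : G.Walk a c, T'.IsPath → (∀ z, z ∈ T'.support ↔ z ∈ T.support) →
          (∀ z, z = x ∨ z = y → z = a ∨ z = c) →
          ∃ R' : G.Walk a b, R'.IsPath ∧ (cons h p).length ≤ R'.length ∧
            ∀ z ∈ R'.support, z ∈ (cons h p).support ∨ z ∈ T.support := by
        intro T' hT' hsupp hends
        refine ⟨T'.append (p.transfer G hpG),
          hT'.append_of_forall_mem_eq (hR.1.transfer hpG) ?_, ?_, ?_⟩
        · intro z hz hzp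
          rw [support_transfer] at hzp
          rcases hends z (hTR z (by simp [hzp]) ((hsupp z).1 hz)) with rfl | rfl
          · exact absurd hzp hR.2
          · rfl
        · have : T'.length ≠ 0 := fun h0 => h.ne (eq_of_length_eq_zero h0)
          simp only [length_cons, length_append, length_transfer]
          omega
        · intro z hz
          rw [mem_support_append_iff, support_transfer, hsupp] at hz
          rcases hz with hz | hz
          · exact .inr hz
          · exact .inl (by simp [hz])
      rcases Sym2.eq_iff.1 hac with ⟨rfl, rfl⟩ | ⟨rfl, rfl⟩
      · exact key T hT (fun _ => Iff.rfl) fun _ => id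
      · exact key T.reverse hT.reverse (by simp) fun _ => Or.symm
    · have hep : s(x, y) ∈ p.edges := by
        rw [edges_cons, List.mem_cons] at he
        exact he.resolve_left hac
      obtain ⟨R', hR', hlen, hsub⟩ := ih hR.1 (fun z hz => hTR z (by simp [hz])) hep
      have haT : a ∉ T.support := by
        intro ha
        rcases hTR a (by simp) ha with rfl | rfl
        · exact hR.2 (p.fst_mem_support_of_mem_edges hep)
        · exact hR.2 (p.snd_mem_support_of_mem_edges hep)
      have hG : G.Adj a c := by
        rcases h with h | h
        · exact h
        · rw [edge_adj] at h
          rcases h.1 with ⟨rfl, rfl⟩ | ⟨rfl, rfl⟩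
          · exact absurd rfl hac
          · exact absurd Sym2.eq_swap hac
      refine ⟨cons hG R', ?_, by simpa using hlen, ?_⟩
      · rw [cons_isPath_iff]
        exact ⟨hR', fun ha => (hsub a ha).elim hR.2 haT⟩
      · intro z hz
        rw [support_cons, List.mem_cons] at hz
        rcases hz with rfl | hz
        · simp
        · exact (hsub z hz).imp_left fun hz => by simp [hz]

/-- If a path of `G` from `x` to `y` meets `R` only in `x` and `y`, then a path `R` of
`G ⊔ edge x y` is no longer than some path of `G`. -/
lemma IsPath.exists_isPath_of_sup_edge {G : SimpleGraph V} {x y : V}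
    {T : G.Walk x y} (hT : T.IsPath) {a b : V} {R : (G ⊔ edge x y).Walk a b} (hR : R.IsPath)
    (hTR : ∀ z ∈ R.support, z ∈ T.support → z = x ∨ z = y) :
    ∃ R' : G.Walk a b, R'.IsPath ∧ R.length ≤ R'.length := by
  by_cases he : s(x, y) ∈ R.edges
  · obtain ⟨R', hR', hlen, -⟩ := hT.exists_isPath_of_mem_edges_sup_edge hR hTR he
    exact ⟨R', hR', hlen⟩
  · have hRG := R.edges_subset_of_notMem_edges_sup_edge he
    exact ⟨R.transfer G hRG, hR.transfer hRG, by simp⟩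

end SimpleGraph.Walk

/-- Vertices reachable from each other in an induced subgraph are joined by a path inside it. -/
lemma SimpleGraph.Reachable.exists_isPath_of_induce {V : Type*} {G : SimpleGraph V} {s : Set V}
    {a b : s} (h : (G.induce s).Reachable a b) :
    ∃ T : G.Walk (a : V) b, T.IsPath ∧ ∀ z ∈ T.support, z ∈ s := by
  obtain ⟨T, hT⟩ := h.exists_isPath
  refine ⟨T.map (Embedding.induce s).toHom, hT.map Subtype.val_injective, fun z hz => ?_⟩
  obtain ⟨w, -, rfl⟩ := List.mem_map.1 ((T.support_map (Embedding.induce s).toHom) ▸ hz)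
  exact w.2

/-- A longest path of `G` contained in the range of `f` lifts to a longest path of `H.comap f`
when no path of `H.comap f` is longer than all paths of `G`. -/
lemma IsLongestPath.exists_comap {V W : Type*} {G H : SimpleGraph V} (hGH : G ≤ H) {f : W → V}
    {u v : V} {P : G.Walk u v} (hP : IsLongestPath G P)
    (hPf : ∀ z ∈ P.support, z ∈ Set.range f)
    (hH : ∀ {a b : W} (R : (H.comap f).Walk a b), R.IsPath →
      ∃ R' : G.Walk (f a) (f b), R'.IsPath ∧ R.length ≤ R'.length) :
    ∃ (a b : W) (P' : (H.comap f).Walk a b),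
      IsLongestPath (H.comap f) P' ∧ P'.support.map f = P.support := by
  obtain ⟨a, b, P', -, hsupp⟩ :=
    (P.mapLe hGH).exists_comap_support_map_eq f (by simpa using hPf)
  rw [Walk.support_mapLe_eq_support] at hsupp
  refine ⟨a, b, P', ⟨?_, fun R hR => ?_⟩, hsupp⟩
  · have := hP.1.support_nodup
    rw [← hsupp] at this
    exact Walk.IsPath.mk' this.of_map
  · obtain ⟨R', hR', hlen⟩ := hH R hR
    have h := congrArg List.length hsupp
    simp only [List.length_map, Walk.length_support] at h
    have := hP.2 R' hR'
    omega

/-- if there is a simple graph `G` with longest paths `P`, `Q` such that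
`|V(P) \ V(Q)| = |V(Q) \ V(P)| = 1`, `|V(P) ∩ V(Q)| = ℓ` and the subgraph induced on the
complement of `V(P) ∩ V(Q)` is connected, then there is a simple graph `G₁` on exactly
`ℓ + 2` vertices with longest paths `P₁`, `Q₁` having the same properties and moreover
`V(G₁) = V(P₁) ∪ V(Q₁)`. -/
theorem statement7 {V : Type*} [Fintype V] (G : SimpleGraph V) (ℓ : ℕ)
    {u₁ v₁ u₂ v₂ : V} (P : G.Walk u₁ v₁) (Q : G.Walk u₂ v₂)
    (hP : IsLongestPath G P) (hQ : IsLongestPath G Q)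
    (hPQ : ({x | x ∈ P.support} \ {x | x ∈ Q.support}).ncard = 1)
    (hQP : ({x | x ∈ Q.support} \ {x | x ∈ P.support}).ncard = 1)
    (hint : ({x | x ∈ P.support} ∩ {x | x ∈ Q.support}).ncard = ℓ)
    (hconn : (G.induce ({x | x ∈ P.support} ∩ {x | x ∈ Q.support})ᶜ).Connected) :
    ∃ (G₁ : SimpleGraph (Fin (ℓ + 2))) (a₁ b₁ c₁ d₁ : Fin (ℓ + 2))
      (P₁ : G₁.Walk a₁ b₁) (Q₁ : G₁.Walk c₁ d₁),
      IsLongestPath G₁ P₁ ∧ IsLongestPath G₁ Q₁ ∧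
      ({x | x ∈ P₁.support} \ {x | x ∈ Q₁.support}).ncard = 1 ∧
      ({x | x ∈ Q₁.support} \ {x | x ∈ P₁.support}).ncard = 1 ∧
      ({x | x ∈ P₁.support} ∩ {x | x ∈ Q₁.support}).ncard = ℓ ∧
      {x | x ∈ P₁.support} ∪ {x | x ∈ Q₁.support} = Set.univ ∧
      (G₁.induce ({x | x ∈ P₁.support} ∩ {x | x ∈ Q₁.support})ᶜ).Connected := by
  obtain ⟨x, hx⟩ := Set.ncard_eq_one.1 hPQ
  obtain ⟨y, hy⟩ := Set.ncard_eq_one.1 hQP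
  have hx' : x ∈ {x | x ∈ P.support} \ {x | x ∈ Q.support} := hx ▸ rfl
  have hy' : y ∈ {x | x ∈ Q.support} \ {x | x ∈ P.support} := hy ▸ rfl
  have hx_of : ∀ z, z ∈ P.support → z ∉ Q.support → z = x := fun z h₁ h₂ => by
    have : z ∈ {x | x ∈ P.support} \ {x | x ∈ Q.support} := ⟨h₁, h₂⟩
    rwa [hx] at this
  have hy_of : ∀ z, z ∈ Q.support → z ∉ P.support → z = y := fun z h₁ h₂ => by
    have : z ∈ {x | x ∈ Q.support} \ {x | x ∈ P.support} := ⟨h₁, h₂⟩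
    rwa [hy] at this
  obtain ⟨T, hT, hTW⟩ : ∃ T : G.Walk x y, T.IsPath ∧
      ∀ z ∈ T.support, ¬ (z ∈ P.support ∧ z ∈ Q.support) :=
    (hconn ⟨x, fun h => hx'.2 h.2⟩ ⟨y, fun h => hy'.2 h.1⟩).exists_isPath_of_induce
  have hcard : ({x | x ∈ P.support} ∪ {x | x ∈ Q.support}).ncard = ℓ + 2 := by
    have h₁ := Set.ncard_inter_add_ncard_sdiff_eq_ncard {x | x ∈ P.support} {x | x ∈ Q.support}
    have h₂ := Set.ncard_sdiff_add_ncard {x | x ∈ Q.support} {x | x ∈ P.support}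
    rw [Set.union_comm]
    omega
  let e := (Finite.equivFinOfCardEq hcard).symm
  let f : Fin (ℓ + 2) → V := fun i => e i
  have hf : Function.Injective f := Subtype.val_injective.comp e.injective
  have hrange : Set.range f = {x | x ∈ P.support} ∪ {x | x ∈ Q.support} := by
    rw [show f = Subtype.val ∘ e from rfl, e.surjective.range_comp, Subtype.range_coe]
  have hPf : ∀ z ∈ P.support, z ∈ Set.range f := fun z hz => hrange ▸ Or.inl hz
  have hQf : ∀ z ∈ Q.support, z ∈ Set.range f := fun z hz => hrange ▸ Or.inr hz
  have hH : ∀ {a b : Fin (ℓ + 2)} (R : ((G ⊔ edge x y).comap f).Walk a b), R.IsPath →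
      ∃ R' : G.Walk (f a) (f b), R'.IsPath ∧ R.length ≤ R'.length := by
    intro a b R hR
    obtain ⟨R', hR', hlen⟩ := Walk.IsPath.exists_isPath_of_sup_edge hT
      (hR.map (f := Hom.comap f (G ⊔ edge x y)) hf) fun z hz hzT => by
        rw [Walk.support_map, List.mem_map] at hz
        obtain ⟨i, -, rfl⟩ := hz
        have hi : f i ∈ {x | x ∈ P.support} ∪ {x | x ∈ Q.support} := hrange ▸ ⟨i, rfl⟩
        have hW := hTW _ hzT
        rcases hi with hi | hi
        · exact .inl (hx_of _ hi fun h => hW ⟨hi, h⟩)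
        · exact .inr (hy_of _ hi fun h => hW ⟨h, hi⟩)
    exact ⟨R', hR', (Walk.length_map ..).symm.trans_le hlen⟩
  obtain ⟨a, b, P', hP', hPs⟩ := hP.exists_comap le_sup_left hPf hH
  obtain ⟨c, d, Q', hQ', hQs⟩ := hQ.exists_comap le_sup_left hQf hH
  have hP_mem : ∀ i, i ∈ P'.support ↔ f i ∈ P.support := fun i => by
    rw [← hPs, List.mem_map_of_injective hf]
  have hQ_mem : ∀ i, i ∈ Q'.support ↔ f i ∈ Q.support := fun i => by
    rw [← hQs, List.mem_map_of_injective hf]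
  have hP_pre : {i | i ∈ P'.support} = f ⁻¹' {x | x ∈ P.support} := Set.ext hP_mem
  have hQ_pre : {i | i ∈ Q'.support} = f ⁻¹' {x | x ∈ Q.support} := Set.ext hQ_mem
  refine ⟨(G ⊔ edge x y).comap f, a, b, c, d, P', Q', hP', hQ', ?_, ?_, ?_, ?_, ?_⟩
  · rwa [hP_pre, hQ_pre, ← Set.preimage_sdiff,
      Set.ncard_preimage_of_injective_subset_range hf fun z hz => hPf z hz.1]
  · rwa [hP_pre, hQ_pre, ← Set.preimage_sdiff,
      Set.ncard_preimage_of_injective_subset_range hf fun z hz => hQf z hz.1]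
  · rwa [hP_pre, hQ_pre, ← Set.preimage_inter,
      Set.ncard_preimage_of_injective_subset_range hf fun z hz => hPf z hz.1]
  · rw [hP_pre, hQ_pre, ← Set.preimage_union, ← hrange, Set.preimage_range]
  · have hends : ∀ i, i ∈ ({i | i ∈ P'.support} ∩ {i | i ∈ Q'.support})ᶜ → f i = x ∨ f i = y := by
      intro i hi
      rw [hP_pre, hQ_pre] at hi
      have hmem : f i ∈ {x | x ∈ P.support} ∪ {x | x ∈ Q.support} := hrange ▸ ⟨i, rfl⟩
      rcases hmem with h | h
      · exact .inl (hx_of _ h fun h' => hi ⟨h, h'⟩)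
      · exact .inr (hy_of _ h fun h' => hi ⟨h', h⟩)
    obtain ⟨i₀, hi₀⟩ := hPf x hx'.1
    have : Nonempty ↥({i | i ∈ P'.support} ∩ {i | i ∈ Q'.support})ᶜ :=
      ⟨i₀, fun h => hx'.2 (hi₀ ▸ (hQ_mem i₀).1 h.2)⟩
    refine ⟨fun i j => ?_⟩
    by_cases hij : i = j
    · exact hij ▸ Reachable.refl i
    · have hne : f i ≠ f j := fun h => hij (Subtype.ext (hf h))
      refine Adj.reachable (show (G ⊔ edge x y).Adj (f i) (f j) from Or.inr ?_)
      rw [edge_adj]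
      refine ⟨?_, hne⟩
      rcases hends i i.2 with hi | hi <;> rcases hends j j.2 with hj | hj
      · exact absurd (hi.trans hj.symm) hne
      · exact .inl ⟨hi, hj⟩
      · exact .inr ⟨hi, hj⟩
      · exact absurd (hi.trans hj.symm) hne
end

section
/- Let G be a simple graph on n vertices with two longest paths P and Q such that V(G) = V(P) ∪ V(Q), where P = p₁p₂⋯p_{n−1} (so P has n − 1 vertices and length n − 2), V(P) \ V(Q) = {p_i}, V(Q) \ V(P) = {q}, and q is adjacent to p_i in G. Then: (a) q is not an endpoint of Q; (b) q is not adjacent in G to p₁ or to p_{n−1}; and (c) for any two distinct indices j and k with q adjacent in G to both p_j and p_k, one has |j − k| > 1; in particular every neighbor p_j of q with j ≠ i satisfies |i − j| > 1. -/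
open SimpleGraph

/-- A vertex off a longest path cannot be inserted between two consecutive pieces of it. -/
theorem IsLongestPath.not_insert {V : Type*} {G : SimpleGraph V} {u v : V} {P : G.Walk u v}
    (hP : IsLongestPath G P) {A B : List V} (hAB : P.support = A ++ B) {q : V}
    (hq : q ∉ P.support) (hA : ∀ x ∈ A.getLast?, G.Adj q x) (hB : ∀ y ∈ B.head?, G.Adj q y) :
    False := by
  have hchain : (A ++ q :: B).IsChain G.Adj := by
    have h := P.isChain_adj_support
    rw [hAB, List.isChain_append] at h
    rw [List.isChain_append, List.isChain_cons]
    refine ⟨h.1, ⟨hB, h.2.1⟩, fun x hx y hy => ?_⟩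
    obtain rfl : q = y := by simpa using hy
    exact (hA x hx).symm
  have hne : A ++ q :: B ≠ [] := by simp
  have hnodup : (A ++ q :: B).Nodup := by
    rw [List.nodup_middle, List.nodup_cons, ← hAB]
    exact ⟨hq, hP.1.support_nodup⟩
  have hle := hP.2 (Walk.ofSupport _ hne hchain) (by
    rwa [Walk.isPath_def, Walk.support_ofSupport])
  have hlen := congrArg List.length hAB
  simp only [Walk.length_ofSupport, Walk.length_support, List.length_append,
    List.length_cons] at hle hlen
  omega

/-- let `G` be a simple graph on `n` vertices with longest paths `P`, `Q`,
`V(G) = V(P) ∪ V(Q)`, `P = p₁ ⋯ p_{n-1}` (encoded by its support being the list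
`[p 1, …, p (n-1)]`), `V(P) \ V(Q) = {p i}`, `V(Q) \ V(P) = {q}` and `q` adjacent to
`p i`.  Then (a) `q` is not an endpoint of `Q`; (b) `q` is not adjacent to `p 1` nor to
`p (n-1)`; (c) any two distinct indices `j ≠ k` of neighbors of `q` on `P` satisfy
`|j - k| > 1`; in particular every neighbor `p j` of `q` with `j ≠ i` has `|i - j| > 1`. -/
theorem statement10 {V : Type*} [Fintype V] (G : SimpleGraph V) (n : ℕ)
    (hcard : Fintype.card V = n)
    {u₁ v₁ u₂ v₂ : V} (P : G.Walk u₁ v₁) (Q : G.Walk u₂ v₂)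
    (hP : IsLongestPath G P) (hQ : IsLongestPath G Q)
    (hcover : {x | x ∈ P.support} ∪ {x | x ∈ Q.support} = Set.univ)
    (p : ℕ → V)
    (hsupp : P.support = (List.range (n - 1)).map (fun t => p (t + 1)))
    (i : ℕ) (hi1 : 1 ≤ i) (hi2 : i ≤ n - 1)
    (hPi : {x | x ∈ P.support} \ {x | x ∈ Q.support} = {p i})
    (q : V) (hq : {x | x ∈ Q.support} \ {x | x ∈ P.support} = {q})
    (hadj : G.Adj q (p i)) :
    (q ≠ u₂ ∧ q ≠ v₂) ∧
    (¬ G.Adj q (p 1) ∧ ¬ G.Adj q (p (n - 1))) ∧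
    (∀ j k : ℕ, 1 ≤ j → j ≤ n - 1 → 1 ≤ k → k ≤ n - 1 → j ≠ k →
      G.Adj q (p j) → G.Adj q (p k) → 1 < ((j : ℤ) - (k : ℤ)).natAbs) ∧
    (∀ j : ℕ, 1 ≤ j → j ≤ n - 1 → j ≠ i → G.Adj q (p j) →
      1 < ((i : ℤ) - (j : ℤ)).natAbs) := by
  have hq' : q ∈ Q.support ∧ q ∉ P.support := hq.symm.subset rfl
  have hpi : p i ∈ P.support ∧ p i ∉ Q.support := hPi.symm.subset rfl
  have key (m : ℕ) (hm : m ≤ n - 1) (h₁ : 0 < m → G.Adj q (p m))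
      (h₂ : m < n - 1 → G.Adj q (p (m + 1))) : False := by
    refine hP.not_insert (List.take_append_drop m P.support).symm hq'.2 ?_ ?_
    · intro x hx
      rw [hsupp, ← List.map_take, List.take_range, min_eq_left hm, List.getLast?_map,
        List.getLast?_range] at hx
      rcases Nat.eq_zero_or_pos m with rfl | h
      · simp at hx
      · have hx' : p (m - 1 + 1) = x := by simpa [h.ne'] using hx
        rw [← hx', Nat.sub_add_cancel h]
        exact h₁ h
    · intro y hy
      rw [hsupp, List.head?_drop, List.getElem?_map] at hy
      by_cases h : m < n - 1
      · have hy' : p (m + 1) = y := by simpa [h] using hy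
        exact hy' ▸ h₂ h
      · simp [h] at hy
  have step (j k : ℕ) (hj1 : 1 ≤ j) (hj2 : j ≤ n - 1) (hk1 : 1 ≤ k) (hk2 : k ≤ n - 1)
      (hjk : j ≠ k) (hj : G.Adj q (p j)) (hk : G.Adj q (p k)) :
      1 < ((j : ℤ) - (k : ℤ)).natAbs := by
    by_contra hlt
    obtain rfl | rfl : k = j + 1 ∨ j = k + 1 := by omega
    · exact key j hj2 (fun _ => hj) fun _ => hk
    · exact key k hk2 (fun _ => hk) fun _ => hj
  refine ⟨⟨?_, ?_⟩, ⟨?_, ?_⟩, step, fun j h1 h2 hne h => step i j hi1 hi2 h1 h2 hne.symm hadj h⟩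
  · rintro rfl
    refine hQ.not_insert (A := []) (B := Q.support) rfl hpi.2 (by simp) fun y hy => ?_
    obtain rfl : q = y := by
      simpa [List.head?_eq_some_head Q.support_ne_nil] using hy
    exact hadj.symm
  · rintro rfl
    refine hQ.not_insert (A := Q.support) (B := []) (by simp) hpi.2 (fun y hy => ?_) (by simp)
    obtain rfl : q = y := by
      simpa [List.getLast?_eq_some_getLast Q.support_ne_nil] using hy
    exact hadj.symm
  · exact fun h => key 0 (Nat.zero_le _) (fun h0 => absurd h0 (lt_irrefl 0)) fun _ => h
  · exact fun h => key (n - 1) le_rfl (fun _ => h) fun h0 => absurd h0 (lt_irrefl _)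
end

section
/- Let G be a simple graph on n vertices with two longest paths P and Q such that V(G) = V(P) ∪ V(Q), |V(P) \ V(Q)| = |V(Q) \ V(P)| = 1, and the subgraph of G induced on V(G) \ (V(P) ∩ V(Q)) is connected. Write P = p₁p₂⋯p_{n−1}. If V(P) \ V(Q) = {p₂}, then there exists a longest path P̃ = p̃₁p̃₂⋯p̃_{n−1} in G such that V(P̃) \ V(Q) and V(Q) \ V(P̃) are singletons, the subgraph of G induced on V(G) \ (V(P̃) ∩ V(Q)) is connected, and V(P̃) \ V(Q) is equal neither to {p̃₂} nor to {p̃_{n−2}}. -/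
open SimpleGraph

/-- If `a ≠ b` both occur in `R` and neither of them is its first entry, then one of them has at
least two entries of `R` before it. -/
theorem List.exists_split_two_le_of_ne_head {α : Type*} {R : List α} {a b : α}
    (ha : a ∈ R) (hb : b ∈ R) (hab : a ≠ b)
    (ha0 : ∀ R', R ≠ a :: R') (hb0 : ∀ R', R ≠ b :: R') :
    ∃ R₁ c R₂, R = R₁ ++ c :: R₂ ∧ 2 ≤ R₁.length ∧ (c = a ∨ c = b) := by
  obtain ⟨S, T, rfl⟩ := List.append_of_mem ha
  match S with
  | [] => exact absurd rfl (ha0 T)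
  | _ :: _ :: _ => exact ⟨_, a, T, rfl, by simp, Or.inl rfl⟩
  | [s] =>
    have hbs : b ≠ s := by
      rintro rfl
      exact hb0 _ rfl
    have hbT : b ∈ T := by simpa [hbs, hab.symm] using hb
    obtain ⟨U, W, rfl⟩ := List.append_of_mem hbT
    exact ⟨s :: a :: U, b, W, by simp, by simp, Or.inr rfl⟩

/-- In a duplicate-free list `A ++ y :: B`, the entry `y` is found only at the index `A.length`. -/
theorem List.Nodup.length_eq_of_getD_append_cons {α : Type*} {A B : List α} {y d : α} {i : ℕ}
    (h : (A ++ y :: B).Nodup) (hi : i < (A ++ y :: B).length)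
    (hy : y = (A ++ y :: B).getD i d) : A.length = i := by
  have hA : A.length < (A ++ y :: B).length := by simp
  rw [List.getD_eq_getElem _ _ hi] at hy
  refine (h.getElem_inj_iff (hi := hA) (hj := hi)).1 ?_
  rw [← hy]
  simp

/-- A duplicate-free chain of adjacent vertices is at most as long as the support of a longest path. -/
theorem IsLongestPath.length_le_of_isChain {V : Type*} {G : SimpleGraph V} {u v : V}
    {P : G.Walk u v} (hP : IsLongestPath G P) {l : List V} (hl : l.IsChain G.Adj)
    (hn : l.Nodup) : l.length ≤ P.support.length := by
  by_cases h0 : l = []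
  · simp [h0]
  · have h := hP.2 (Walk.ofSupport l h0 hl)
      (Walk.IsPath.mk' (by rwa [Walk.support_ofSupport]))
    rw [Walk.length_ofSupport] at h
    rw [Walk.length_support]
    omega

/-- Suppose `x y R` and `L` are longest paths such that `y` has a neighbour `q` outside `x y R`,
while `L` contains `x` but not `y` and uses only `q` and vertices of `x y R`. Then `x` is adjacent
to some vertex of `R` preceded by at least two others. -/
theorem SimpleGraph.exists_adj_split_of_longest {V : Type*} {G : SimpleGraph V} {x y q : V}
    {R L : List V}
    (hmax : ∀ l : List V, l.IsChain G.Adj → l.Nodup → l.length ≤ R.length + 2)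
    (hc : (x :: y :: R).IsChain G.Adj) (hn : (x :: y :: R).Nodup)
    (hq : q ∉ x :: y :: R) (hyq : G.Adj y q)
    (hLc : L.IsChain G.Adj) (hLn : L.Nodup) (hLlen : L.length = R.length + 2)
    (hLsub : ∀ z ∈ L, z = q ∨ z ∈ x :: y :: R) (hyL : y ∉ L) (hxL : x ∈ L) :
    ∃ R₁ c R₂, R = R₁ ++ c :: R₂ ∧ 2 ≤ R₁.length ∧ G.Adj x c := by
  have hxy : G.Adj x y := (List.isChain_cons_cons.1 hc).1
  have hyR := (List.isChain_cons_cons.1 hc).2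
  simp only [List.mem_cons, not_or] at hq
  simp only [List.nodup_cons, List.mem_cons, not_or] at hn
  have hxq : ¬ G.Adj x q := fun h => by
    have := hmax (q :: x :: y :: R) (List.isChain_cons_cons.2 ⟨h.symm, hc⟩)
      (by simp only [List.nodup_cons, List.mem_cons, not_or]; tauto)
    simp at this
  have hhead : ∀ a, G.Adj x a → ∀ R', R ≠ a :: R' := by
    rintro a ha R' rfl
    have := hmax (q :: y :: x :: a :: R')
      (by
        simp only [List.isChain_cons_cons] at hyR ⊢
        exact ⟨hyq.symm, hxy.symm, ha, hyR.2⟩)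
      (by simp only [List.nodup_cons, List.mem_cons, not_or] at *; tauto)
    simp at this
  have hmem : ∀ a ∈ L, G.Adj x a → a ∈ R := by
    intro a ha hxa
    have h1 : a ≠ q := by rintro rfl; exact hxq hxa
    have h2 : a ≠ x := hxa.ne'
    have h3 : a ≠ y := by rintro rfl; exact hyL ha
    simpa [h1, h2, h3] using hLsub a ha
  obtain ⟨A, B, rfl⟩ := List.append_of_mem hxL
  obtain rfl | ⟨A, a, rfl⟩ := A.eq_nil_or_concat'
  · have := hmax (y :: x :: B) (List.isChain_cons_cons.2 ⟨hxy.symm, by simpa using hLc⟩)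
      (List.nodup_cons.2 ⟨by simpa using hyL, by simpa using hLn⟩)
    simp at this hLlen
    omega
  match B with
  | [] =>
    have := hmax (((A ++ [a]) ++ [x]) ++ [y])
      (by
        rw [List.append_assoc _ [x]]
        exact List.isChain_append_cons_cons.2 ⟨hLc, hxy, List.isChain_singleton _⟩)
      (by
        rw [← List.concat_eq_append]
        exact hLn.concat hyL)
    simp at this hLlen
    omega
  | b :: B =>
    have hab : a ≠ b := by
      rintro rfl
      simp [List.nodup_append] at hLn
    have hax : G.Adj x a := by
      rw [List.append_assoc] at hLc
      exact (List.isChain_append_cons_cons.1 hLc).2.1.symm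
    have hxb : G.Adj x b := (List.isChain_append_cons_cons.1 hLc).2.1
    obtain ⟨R₁, c, R₂, hR, hlen, hcc⟩ := List.exists_split_two_le_of_ne_head
      (hmem a (by simp) hax) (hmem b (by simp) hxb) hab (hhead a hax) (hhead b hxb)
    refine ⟨R₁, c, R₂, hR, hlen, ?_⟩
    rcases hcc with rfl | rfl <;> assumption

/-- If a connected induced subgraph has exactly two vertices, these are adjacent. -/
theorem SimpleGraph.adj_of_connected_induce_pair {V : Type*} {G : SimpleGraph V} {s : Set V}
    {x y : V} (h : (G.induce s).Connected) (hs : s = {x, y}) (hxy : x ≠ y) : G.Adj x y := by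
  subst hs
  have : Nontrivial ({x, y} : Set V) :=
    ⟨⟨x, by simp⟩, ⟨y, by simp⟩, by simpa using hxy⟩
  obtain ⟨⟨z, hz⟩, hadj⟩ := h.preconnected.exists_adj_of_nontrivial ⟨x, by simp⟩
  rw [induce_adj] at hadj
  rcases hz with rfl | rfl
  · exact absurd rfl hadj.ne
  · exact hadj

/-- let `G` be a simple graph on `n` vertices with longest paths `P`, `Q`,
`V(G) = V(P) ∪ V(Q)`, `|V(P) \ V(Q)| = |V(Q) \ V(P)| = 1`, the subgraph induced on the
complement of `V(P) ∩ V(Q)` connected, and `P = p₁ ⋯ p_{n-1}` with `V(P) \ V(Q) = {p₂}`.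
Then there is a longest path `P̃ = p̃₁ ⋯ p̃_{n-1}` in `G` such that `V(P̃) \ V(Q)` and
`V(Q) \ V(P̃)` are singletons, the subgraph induced on the complement of `V(P̃) ∩ V(Q)`
is connected, and `V(P̃) \ V(Q)` is neither `{p̃₂}` nor `{p̃_{n-2}}`. -/
theorem statement11 {V : Type*} [Fintype V] (G : SimpleGraph V) (n : ℕ)
    (hcard : Fintype.card V = n)
    {u₁ v₁ u₂ v₂ : V} (P : G.Walk u₁ v₁) (Q : G.Walk u₂ v₂)
    (hP : IsLongestPath G P) (hQ : IsLongestPath G Q)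
    (hcover : {x | x ∈ P.support} ∪ {x | x ∈ Q.support} = Set.univ)
    (hPQ : ({x | x ∈ P.support} \ {x | x ∈ Q.support}).ncard = 1)
    (hQP : ({x | x ∈ Q.support} \ {x | x ∈ P.support}).ncard = 1)
    (hconn : (G.induce ({x | x ∈ P.support} ∩ {x | x ∈ Q.support})ᶜ).Connected)
    (p : ℕ → V)
    (hsupp : P.support = (List.range (n - 1)).map (fun t => p (t + 1)))
    (hP2 : {x | x ∈ P.support} \ {x | x ∈ Q.support} = {p 2}) :
    ∃ (a b : V) (P' : G.Walk a b) (p' : ℕ → V),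
      IsLongestPath G P' ∧
      P'.support = (List.range (n - 1)).map (fun t => p' (t + 1)) ∧
      (∃ x : V, {x | x ∈ P'.support} \ {x | x ∈ Q.support} = {x}) ∧
      (∃ y : V, {x | x ∈ Q.support} \ {x | x ∈ P'.support} = {y}) ∧
      (G.induce ({x | x ∈ P'.support} ∩ {x | x ∈ Q.support})ᶜ).Connected ∧
      {x | x ∈ P'.support} \ {x | x ∈ Q.support} ≠ {p' 2} ∧
      {x | x ∈ P'.support} \ {x | x ∈ Q.support} ≠ {p' (n - 2)} := by
  obtain ⟨q, hq⟩ := Set.ncard_eq_one.1 hQP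
  have hPc := P.isChain_adj_support
  have hPn := hP.1.support_nodup
  have hqQ : q ∈ Q.support ∧ q ∉ P.support := (Set.ext_iff.1 hq q).2 rfl
  have h2P : p 2 ∈ P.support ∧ p 2 ∉ Q.support := (Set.ext_iff.1 hP2 (p 2)).2 rfl
  have hsub : ∀ z, z ∈ Q.support → z = q ∨ z ∈ P.support := fun z hz => by
    by_cases h : z ∈ P.support
    · exact Or.inr h
    · exact Or.inl ((Set.ext_iff.1 hq z).1 ⟨hz, h⟩)
  have hadj : G.Adj (p 2) q := by
    refine adj_of_connected_induce_pair hconn ?_ (fun h => hqQ.2 (h ▸ h2P.1))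
    rw [Set.insert_eq, ← hP2, ← hq]
    ext z
    have : z ∈ P.support ∨ z ∈ Q.support := (Set.ext_iff.1 hcover z).2 trivial
    simp only [Set.mem_compl_iff, Set.mem_inter_iff, Set.mem_union, Set.mem_sdiff,
      Set.mem_ofPred_eq]
    tauto
  have hmax : ∀ l : List V, l.IsChain G.Adj → l.Nodup → l.length ≤ P.support.length :=
    fun l => hP.length_le_of_isChain
  have hlenP : P.support.length = n - 1 := by simp [hsupp]
  have hlenQ : Q.support.length = P.support.length :=
    le_antisymm (hmax _ Q.isChain_adj_support hQ.1.support_nodup)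
      (hQ.length_le_of_isChain hPc hPn)
  obtain ⟨R, hR⟩ : ∃ R, P.support = p 1 :: p 2 :: R := by
    have h2 : 2 ≤ P.support.length :=
      hmax [p 2, q] (by simpa using hadj) (by simpa using hadj.ne)
    obtain ⟨k, hk⟩ := Nat.exists_eq_add_of_le' (hlenP ▸ h2)
    exact ⟨_, by rw [hsupp, hk, List.range_succ_eq_map, List.range_succ_eq_map]; rfl⟩
  have hPset : {x | x ∈ P.support} = {x | x ∈ p 1 :: p 2 :: R} := by rw [hR]
  rw [hR] at hPc hPn hqQ hmax hlenP hlenQ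
  have h1Q : p 1 ∈ Q.support := by
    by_contra h
    have : p 1 = p 2 := (Set.ext_iff.1 hP2 (p 1)).1 ⟨by simp [hR], h⟩
    simp [this] at hPn
  obtain ⟨R₁, c, R₂, rfl, hlen, hc⟩ := exists_adj_split_of_longest hmax hPc hPn hqQ.2 hadj
    Q.isChain_adj_support hQ.1.support_nodup hlenQ (by simpa only [hR] using hsub) h2P.2 h1Q
  set l := R₁.reverse ++ p 2 :: p 1 :: c :: R₂ with hl
  have hperm : l.Perm (p 1 :: p 2 :: (R₁ ++ c :: R₂)) := by
    refine (List.perm_middle.trans (List.perm_middle.cons _)).trans ?_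
    exact (List.Perm.swap _ _ _).trans
      ((((List.reverse_perm R₁).append_right _).cons _).cons _)
  have hln : l.Nodup := hperm.nodup_iff.2 hPn
  have hlc : l.IsChain G.Adj := by
    have h12 : G.Adj (p 1) (p 2) := (List.isChain_cons_cons.1 hPc).1
    have hy := (List.isChain_cons_cons.1 hPc).2
    rw [← List.cons_append, List.isChain_split] at hy
    rw [hl, List.isChain_split]
    refine ⟨?_, List.isChain_cons_cons.2 ⟨h12.symm, List.isChain_cons_cons.2 ⟨hc, hy.2⟩⟩⟩
    rw [← List.reverse_cons, List.isChain_reverse]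
    have := List.IsChain.left_of_append hy.1
    exact this.imp fun _ _ h => h.symm
  have hl0 : l ≠ [] := by simp [hl]
  have hllen : l.length = n - 1 := hperm.length_eq.trans hlenP
  have hset : {x | x ∈ (Walk.ofSupport l hl0 hlc).support} = {x | x ∈ P.support} := by
    rw [hPset, Walk.support_ofSupport]
    ext z
    exact hperm.mem_iff
  have hne : ∀ i, i < n - 1 → i ≠ R₁.length → ({p 2} : Set V) ≠ {l.getD i (p 2)} := by
    intro i hi hiR h
    refine hiR ?_
    have := List.Nodup.length_eq_of_getD_append_cons hln (hllen ▸ hi)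
      (Set.singleton_injective h)
    simpa using this.symm
  have hn3 : n - 1 = R₁.length + R₂.length + 3 := by
    rw [← hlenP]
    simp
    omega
  refine ⟨_, _, Walk.ofSupport l hl0 hlc, fun t => l.getD (t - 1) (p 2), ⟨?_, ?_⟩, ?_, ?_, ?_,
    ?_, ?_, ?_⟩
  · exact Walk.IsPath.mk' (by rwa [Walk.support_ofSupport])
  · intro a b W hW
    refine (hP.2 W hW).trans (le_of_eq ?_)
    have := P.length_support
    rw [Walk.length_ofSupport, hllen, ← hlenP, ← hR]
    omega
  · rw [Walk.support_ofSupport]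
    refine List.ext_getElem (by simp [hllen]) fun i h₁ h₂ => ?_
    simp [List.getElem?_eq_getElem h₁]
  · exact ⟨p 2, by rw [hset, hP2]⟩
  · exact ⟨q, by rw [hset, hq]⟩
  · rwa [hset]
  · rw [hset, hP2]
    exact hne _ (by omega) (by omega)
  · rw [hset, hP2]
    exact hne _ (by omega) (by omega)
end

section
/- Let G be a simple graph on n vertices with two longest paths P and Q such that V(G) = V(P) ∪ V(Q), where P = p₁p₂⋯p_{n−1} (so both P and Q have n − 1 vertices and length n − 2), V(P) \ V(Q) = {p_i} with 1 < i < n − 1, V(Q) \ V(P) = {q}, q is adjacent in G to p_i, and the two edges of Q incident to q join q to p_j and p_k, where 1 < j < k < n − 1 and |i − j| > 1, |k − i| > 1, |k − j| > 1. Then for each x ∈ {j, k}, none of the pairs {p₁, p_{x+1}}, {p_{x−1}, p_{n−1}}, {p_{i−1}, p_{x−1}}, {p_{i+1}, p_{x+1}} is an edge of Q. -/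
open SimpleGraph

/-- A vertex missed by a longest path cannot be merged with its vertices into a single path. -/
theorem IsLongestPath.not_isChain_of_perm_cons {V : Type*} {G : SimpleGraph V} {u v : V}
    {P : G.Walk u v} (hP : IsLongestPath G P) {q : V} (hq : q ∉ P.support) {l : List V}
    (hl : l.Perm (q :: P.support)) : ¬ l.IsChain G.Adj := by
  intro hc
  have hne : l ≠ [] := by
    rintro rfl
    simp at hl
  have hnd : l.Nodup := hl.nodup_iff.2 (List.nodup_cons.2 ⟨hq, hP.1.support_nodup⟩)
  have hle := hP.2 (Walk.ofSupport l hne hc)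
    ((Walk.isPath_def _).2 (by rwa [Walk.support_ofSupport]))
  have hlen := hl.length_eq
  rw [Walk.length_ofSupport, hlen] at hle
  simp at hle

/-- The list `p a, p (a + 1), …, p b`. -/
def mapIcc {V : Type*} (p : ℕ → V) (a b : ℕ) : List V :=
  (List.range' a (b + 1 - a)).map p

section MapIcc

variable {V : Type*} (p : ℕ → V) {a b c : ℕ}

theorem head?_mapIcc (h : a ≤ b) : (mapIcc p a b).head? = some (p a) := by
  obtain ⟨d, rfl⟩ := Nat.exists_eq_add_of_le h
  simp [mapIcc, show a + d + 1 - a = d + 1 by omega, List.range'_succ]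

theorem getLast?_mapIcc (h : a ≤ b) : (mapIcc p a b).getLast? = some (p b) := by
  obtain ⟨d, rfl⟩ := Nat.exists_eq_add_of_le h
  simp [mapIcc, show a + d + 1 - a = d + 1 by omega, List.range'_concat]

theorem mapIcc_append (h : a ≤ b + 1) (h' : b ≤ c) :
    mapIcc p a b ++ mapIcc p (b + 1) c = mapIcc p a c := by
  obtain ⟨d, hd⟩ := Nat.exists_eq_add_of_le h
  obtain ⟨e, rfl⟩ := Nat.exists_eq_add_of_le h'
  rw [mapIcc, mapIcc, mapIcc, ← List.map_append, hd, show a + d - a = d by omega,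
    show b + e + 1 - (a + d) = e by omega, show b + e + 1 - a = d + e by omega,
    List.range'_append_1]

theorem isChain_mapIcc {R : V → V → Prop} (h : ∀ t, a ≤ t → t < b → R (p t) (p (t + 1))) :
    (mapIcc p a b).IsChain R := by
  rw [mapIcc, List.isChain_iff_getElem]
  intro t ht
  simp only [List.length_map, List.length_range'] at ht
  simpa [add_assoc] using h (a + t) (by omega) (by omega)

theorem rel_of_isChain_mapIcc {R : V → V → Prop} (h : (mapIcc p a b).IsChain R) {t : ℕ}
    (hat : a ≤ t) (htb : t < b) : R (p t) (p (t + 1)) := by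
  rw [mapIcc, List.isChain_iff_getElem] at h
  obtain ⟨d, rfl⟩ := Nat.exists_eq_add_of_le hat
  have := h d (by rw [List.length_map, List.length_range']; omega)
  simpa only [List.getElem_map, List.getElem_range', one_mul, add_assoc] using this

theorem isChain_append_of_rel {R : V → V → Prop} {l₁ l₂ : List V} {x y : V}
    (h₁ : l₁.IsChain R) (h₂ : l₂.IsChain R) (hx : l₁.getLast? = some x)
    (hy : l₂.head? = some y) (h : R x y) : (l₁ ++ l₂).IsChain R :=
  List.isChain_append.2 ⟨h₁, h₂, by simp_all⟩

end MapIcc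

section Rerouting

variable {V : Type*} {G : SimpleGraph V} {u v : V} {P : G.Walk u v} {q : V} {p : ℕ → V} {m : ℕ}

theorem IsLongestPath.isChain_mapIcc (hsupp : P.support = mapIcc p 1 m) {a b : ℕ}
    (ha : 1 ≤ a) (hb : b ≤ m) : (mapIcc p a b).IsChain G.Adj :=
  _root_.isChain_mapIcc p fun _ h₁ h₂ ↦
    rel_of_isChain_mapIcc p (hsupp ▸ P.isChain_adj_support) (ha.trans h₁) (h₂.trans_le hb)

theorem IsLongestPath.isChain_mapIcc_reverse (hsupp : P.support = mapIcc p 1 m) {a b : ℕ}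
    (ha : 1 ≤ a) (hb : b ≤ m) : (mapIcc p a b).reverse.IsChain G.Adj := by
  simpa only [List.isChain_reverse, G.adj_comm] using isChain_mapIcc hsupp ha hb

/-- Rerouting through `q, p x, …, p 1, p (x + 1), …, p m`. -/
theorem IsLongestPath.not_adj_first (hP : IsLongestPath G P)
    (hsupp : P.support = mapIcc p 1 m) (hq : q ∉ P.support) {x : ℕ} (hx : 1 ≤ x) (hxm : x < m)
    (hqx : G.Adj q (p x)) : ¬ G.Adj (p 1) (p (x + 1)) := by
  intro h
  refine hP.not_isChain_of_perm_cons hq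
    (l := [q] ++ (mapIcc p 1 x).reverse ++ mapIcc p (x + 1) m) ?_ ?_
  · rw [hsupp, ← mapIcc_append p (by omega : 1 ≤ x + 1) hxm.le]
    exact .cons q ((List.reverse_perm _).append_right _)
  · refine isChain_append_of_rel (isChain_append_of_rel (.singleton q)
      (isChain_mapIcc_reverse hsupp le_rfl hxm.le) rfl ?_ hqx)
      (isChain_mapIcc hsupp (by omega) le_rfl) ?_ (head?_mapIcc p hxm) h
    · simp [getLast?_mapIcc p hx]
    · simp [List.getLast?_cons, head?_mapIcc p hx]

/-- Rerouting through `p 1, …, p (x - 1), p m, …, p x, q`. -/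
theorem IsLongestPath.not_adj_last (hP : IsLongestPath G P)
    (hsupp : P.support = mapIcc p 1 m) (hq : q ∉ P.support) {x : ℕ} (hx : 1 ≤ x) (hxm : x < m)
    (hqx : G.Adj q (p (x + 1))) : ¬ G.Adj (p x) (p m) := by
  intro h
  refine hP.not_isChain_of_perm_cons hq
    (l := mapIcc p 1 x ++ (mapIcc p (x + 1) m).reverse ++ [q]) ?_ ?_
  · rw [hsupp, ← mapIcc_append p (by omega : 1 ≤ x + 1) hxm.le]
    refine List.perm_append_comm.trans ?_
    simp [List.reverse_perm, List.perm_append_left_iff]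
  · refine isChain_append_of_rel (isChain_append_of_rel (isChain_mapIcc hsupp le_rfl hxm.le)
      (isChain_mapIcc_reverse hsupp (by omega) le_rfl) (getLast?_mapIcc p hx) ?_ h)
      (.singleton q) ?_ rfl hqx.symm
    · simp [getLast?_mapIcc p hxm]
    · simp [head?_mapIcc p hxm]

/-- Rerouting through `p 1, …, p a, p b, …, p (a + 1), q, p (b + 1), …, p m`. -/
theorem IsLongestPath.not_adj_pred (hP : IsLongestPath G P)
    (hsupp : P.support = mapIcc p 1 m) (hq : q ∉ P.support) {a b : ℕ} (ha : 1 ≤ a) (hab : a < b)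
    (hbm : b < m) (hqa : G.Adj q (p (a + 1))) (hqb : G.Adj q (p (b + 1))) :
    ¬ G.Adj (p a) (p b) := by
  intro h
  refine hP.not_isChain_of_perm_cons hq (l := mapIcc p 1 a ++ (mapIcc p (a + 1) b).reverse ++
    ([q] ++ mapIcc p (b + 1) m)) ?_ ?_
  · rw [hsupp, ← mapIcc_append p (by omega : 1 ≤ b + 1) hbm.le,
      ← mapIcc_append p (by omega : 1 ≤ a + 1) hab.le]
    refine List.perm_middle.trans (.cons q (.append_right _ ?_))
    exact (List.reverse_perm _).append_left _
  · refine isChain_append_of_rel (isChain_append_of_rel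
      (isChain_mapIcc hsupp le_rfl (by omega)) (isChain_mapIcc_reverse hsupp (by omega) hbm.le)
      (getLast?_mapIcc p ha) ?_ h) (isChain_append_of_rel (.singleton q)
      (isChain_mapIcc hsupp (by omega) le_rfl) rfl (head?_mapIcc p hbm) hqb) ?_ rfl hqa.symm
    · simp [getLast?_mapIcc p hab]
    · simp [head?_mapIcc p hab]

/-- Rerouting through `p 1, …, p a, q, p b, …, p (a + 1), p (b + 1), …, p m`. -/
theorem IsLongestPath.not_adj_succ (hP : IsLongestPath G P)
    (hsupp : P.support = mapIcc p 1 m) (hq : q ∉ P.support) {a b : ℕ} (ha : 1 ≤ a) (hab : a < b)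
    (hbm : b < m) (hqa : G.Adj q (p a)) (hqb : G.Adj q (p b)) :
    ¬ G.Adj (p (a + 1)) (p (b + 1)) := by
  intro h
  refine hP.not_isChain_of_perm_cons hq (l := mapIcc p 1 a ++
    ([q] ++ (mapIcc p (a + 1) b).reverse ++ mapIcc p (b + 1) m)) ?_ ?_
  · rw [hsupp, ← mapIcc_append p (by omega : 1 ≤ b + 1) hbm.le,
      ← mapIcc_append p (by omega : 1 ≤ a + 1) hab.le, List.append_assoc, List.append_assoc]
    refine List.perm_middle.trans (.cons q (.append_left _ ?_))
    exact (List.reverse_perm _).append_right _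
  · refine isChain_append_of_rel (isChain_mapIcc hsupp le_rfl (by omega))
      (isChain_append_of_rel (isChain_append_of_rel (.singleton q)
        (isChain_mapIcc_reverse hsupp (by omega) hbm.le) rfl ?_ hqb)
        (isChain_mapIcc hsupp (by omega) le_rfl) ?_ (head?_mapIcc p hbm) h)
      (getLast?_mapIcc p ha) rfl hqa.symm
    · simp [getLast?_mapIcc p hab]
    · simp [List.getLast?_cons, head?_mapIcc p hab]

end Rerouting

/-- forbidden pairs of vertices that cannot be joined by an edge of `Q`. -/
theorem statement13 {V : Type*} [Fintype V] (G : SimpleGraph V) (n : ℕ)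
    (hcard : Fintype.card V = n)
    {u₁ v₁ u₂ v₂ : V} (P : G.Walk u₁ v₁) (Q : G.Walk u₂ v₂)
    (hP : IsLongestPath G P) (hQ : IsLongestPath G Q)
    (hcover : {x | x ∈ P.support} ∪ {x | x ∈ Q.support} = Set.univ)
    (p : ℕ → V)
    (hsupp : P.support = (List.range (n - 1)).map (fun t => p (t + 1)))
    (i : ℕ) (hi1 : 1 < i) (hi2 : i < n - 1)
    (hPi : {x | x ∈ P.support} \ {x | x ∈ Q.support} = {p i})
    (q : V) (hq : {x | x ∈ Q.support} \ {x | x ∈ P.support} = {q})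
    (hadj : G.Adj q (p i))
    (j k : ℕ) (hj1 : 1 < j) (hjk : j < k) (hk2 : k < n - 1)
    (hqj : s(q, p j) ∈ Q.edges) (hqk : s(q, p k) ∈ Q.edges)
    (hij : 1 < ((i : ℤ) - (j : ℤ)).natAbs)
    (hki : 1 < ((k : ℤ) - (i : ℤ)).natAbs)
    (hkj : 1 < ((k : ℤ) - (j : ℤ)).natAbs) :
    ∀ x : ℕ, (x = j ∨ x = k) →
      s(p 1, p (x + 1)) ∉ Q.edges ∧
      s(p (x - 1), p (n - 1)) ∉ Q.edges ∧
      s(p (i - 1), p (x - 1)) ∉ Q.edges ∧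
      s(p (i + 1), p (x + 1)) ∉ Q.edges := by
  have hseg : P.support = mapIcc p 1 (n - 1) := by
    rw [hsupp, mapIcc, Nat.add_sub_cancel, List.range'_eq_map_range, List.map_map]
    exact List.map_congr_left fun t _ ↦ by simp [add_comm]
  have hqP : q ∉ P.support := (hq.symm.subset rfl : q ∈ {x | x ∈ Q.support} \ {x | x ∈ P.support}).2
  intro x hx
  have hqx : G.Adj q (p x) := by
    rcases hx with rfl | rfl
    exacts [Q.adj_of_mem_edges hqj, Q.adj_of_mem_edges hqk]
  obtain ⟨y, rfl⟩ : ∃ y, x = y + 1 := ⟨x - 1, by omega⟩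
  obtain ⟨i, rfl⟩ : ∃ i', i = i' + 1 := ⟨i - 1, by omega⟩
  simp only [Nat.add_sub_cancel]
  refine ⟨fun h ↦ ?_, fun h ↦ ?_, fun h ↦ ?_, fun h ↦ ?_⟩ <;>
    replace h := Q.adj_of_mem_edges h
  · exact hP.not_adj_first hseg hqP (by omega) (by omega) hqx h
  · exact hP.not_adj_last hseg hqP (by omega : 1 ≤ y) (by omega) hqx h
  · rcases lt_or_ge i y with hlt | hge
    · exact hP.not_adj_pred hseg hqP (by omega) hlt (by omega) hadj hqx h
    · exact hP.not_adj_pred hseg hqP (by omega) (by omega : y < i) (by omega) hqx hadj h.symm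
  · rcases lt_or_ge i y with hlt | hge
    · exact hP.not_adj_succ hseg hqP (by omega) (by omega : i + 1 < y + 1) (by omega) hadj hqx h
    · exact hP.not_adj_succ hseg hqP (by omega) (by omega : y + 1 < i + 1) (by omega) hqx hadj h.symm
end

section
/- Let G be a simple graph on n vertices with two longest paths P and Q such that V(G) = V(P) ∪ V(Q), where P = p₁p₂⋯p_{n−1} (so both P and Q have n − 1 vertices and length n − 2), V(P) \ V(Q) = {p_i} with 1 < i < n − 1, V(Q) \ V(P) = {q}, q is adjacent in G to p_i, and the two edges of Q incident to q join q to p_j and p_k, where 1 < j < k < n − 1 and |i − j| > 1, |k − i| > 1, |k − j| > 1. Then: if j < i then {p₁, p_{i−1}} is not an edge of Q, and if k > i then {p_{i+1}, p_{n−1}} is not an edge of Q. -/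
open SimpleGraph

/-- No path visits one vertex more than a longest path. -/
theorem IsLongestPath.false_of_perm_cons_support {V : Type*} {G : SimpleGraph V} {u v q : V}
    {P : G.Walk u v} (hP : IsLongestPath G P) (hq : q ∉ P.support) {l : List V}
    (hchain : l.IsChain G.Adj) (hperm : l.Perm (q :: P.support)) : False := by
  have hne : l ≠ [] := by
    rintro rfl
    simp at hperm
  have hpath : (Walk.ofSupport l hne hchain).IsPath := by
    rw [Walk.isPath_def, Walk.support_ofSupport, hperm.nodup_iff, List.nodup_cons]
    exact ⟨hq, hP.1.support_nodup⟩
  have hle := hP.2 _ hpath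
  rw [Walk.length_ofSupport, hperm.length_eq, List.length_cons, Walk.length_support] at hle
  omega

/-- Suppose the support of a longest path splits as `A ++ B ++ C`. If the last vertex of `B` is
adjacent to the first vertex of `A`, then no vertex off the path is adjacent to both the last
vertex of `A` and the first vertex of `C`. -/
theorem IsLongestPath.false_of_support_eq_append {V : Type*} {G : SimpleGraph V} {u v q : V}
    {P : G.Walk u v} (hP : IsLongestPath G P) (hq : q ∉ P.support) {A B C : List V}
    (hsupp : P.support = A ++ B ++ C) (hA : A ≠ [])
    (hBA : ∀ x ∈ B.getLast?, ∀ y ∈ A.head?, G.Adj x y)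
    (hAq : ∀ x ∈ A.getLast?, G.Adj x q) (hqC : ∀ y ∈ C.head?, G.Adj q y) : False := by
  have hchain := P.isChain_adj_support
  rw [hsupp, List.isChain_append, List.isChain_append] at hchain
  obtain ⟨⟨chainA, chainB, -⟩, chainC, -⟩ := hchain
  refine hP.false_of_perm_cons_support hq (l := B ++ A ++ q :: C) ?_ ?_
  · rw [List.isChain_append, List.isChain_append, List.isChain_cons]
    refine ⟨⟨chainB, chainA, hBA⟩, ⟨hqC, chainC⟩, ?_⟩
    rw [List.getLast?_append_of_ne_nil _ hA]
    simpa using hAq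
  · rw [hsupp]
    exact List.perm_middle.trans ((List.perm_append_comm.append_right C).cons q)

theorem IsLongestPath.reverse {V : Type*} {G : SimpleGraph V} {u v : V} {P : G.Walk u v}
    (hP : IsLongestPath G P) : IsLongestPath G P.reverse :=
  ⟨hP.1.reverse, fun Q hQ => by simpa using hP.2 Q hQ⟩

/-- forbidden pairs of vertices that cannot be joined by an edge of `Q`. -/
theorem statement15 {V : Type*} [Fintype V] (G : SimpleGraph V) (n : ℕ)
    (hcard : Fintype.card V = n)
    {u₁ v₁ u₂ v₂ : V} (P : G.Walk u₁ v₁) (Q : G.Walk u₂ v₂)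
    (hP : IsLongestPath G P) (hQ : IsLongestPath G Q)
    (hcover : {x | x ∈ P.support} ∪ {x | x ∈ Q.support} = Set.univ)
    (p : ℕ → V)
    (hsupp : P.support = (List.range (n - 1)).map (fun t => p (t + 1)))
    (i : ℕ) (hi1 : 1 < i) (hi2 : i < n - 1)
    (hPi : {x | x ∈ P.support} \ {x | x ∈ Q.support} = {p i})
    (q : V) (hq : {x | x ∈ Q.support} \ {x | x ∈ P.support} = {q})
    (hadj : G.Adj q (p i))
    (j k : ℕ) (hj1 : 1 < j) (hjk : j < k) (hk2 : k < n - 1)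
    (hqj : s(q, p j) ∈ Q.edges) (hqk : s(q, p k) ∈ Q.edges)
    (hij : 1 < ((i : ℤ) - (j : ℤ)).natAbs)
    (hki : 1 < ((k : ℤ) - (i : ℤ)).natAbs)
    (hkj : 1 < ((k : ℤ) - (j : ℤ)).natAbs) :
    (j < i → s(p 1, p (i - 1)) ∉ Q.edges) ∧
    (i < k → s(p (i + 1), p (n - 1)) ∉ Q.edges) := by
  have hqP : q ∉ P.support := (hq.symm ▸ Set.mem_singleton q :
    q ∈ {x | x ∈ Q.support} \ {x | x ∈ P.support}).2
  have hsupp' : P.support = (List.range' 1 (n - 1)).map p := by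
    rw [hsupp, List.range'_eq_map_range, List.map_map]
    exact List.map_congr_left fun t _ => by simp [add_comm]
  have hsplit : ∀ a b, 1 ≤ a → a ≤ b → b ≤ n → P.support =
      (List.range' 1 (a - 1)).map p ++ (List.range' a (b - a)).map p ++
        (List.range' b (n - b)).map p := by
    intro a b ha hab hbn
    have h₁ : List.range' 1 (a - 1) ++ List.range' a (b - a) = List.range' 1 (b - 1) := by
      have := @List.range'_append_1 1 (a - 1) (b - a)
      rwa [show 1 + (a - 1) = a by omega, show a - 1 + (b - a) = b - 1 by omega] at this
    have h₂ : List.range' 1 (b - 1) ++ List.range' b (n - b) = List.range' 1 (n - 1) := by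
      have := @List.range'_append_1 1 (b - 1) (n - b)
      rwa [show 1 + (b - 1) = b by omega, show b - 1 + (n - b) = n - 1 by omega] at this
    rw [hsupp', ← List.map_append, ← List.map_append, h₁, h₂]
  have hadj_j : G.Adj q (p j) := Q.adj_of_mem_edges hqj
  have hadj_k : G.Adj q (p k) := Q.adj_of_mem_edges hqk
  refine ⟨fun hji he => ?_, fun hik he => ?_⟩
  · have hadj' : G.Adj (p 1) (p (i - 1)) := Q.adj_of_mem_edges he
    refine hP.false_of_support_eq_append hqP
      (hsplit (j + 1) i (by omega) (by omega) (by omega)) ?_ ?_ ?_ ?_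
    · simp; omega
    · have e : j + 1 + (i - (j + 1)) - 1 = i - 1 := by omega
      simp [List.head?_range', List.getLast?_range', e, hadj'.symm]
    · have e : 1 + j - 1 = j := by omega
      simp [List.getLast?_range', e, hadj_j.symm]
    · simp [List.head?_range', hadj]
  · have hadj' : G.Adj (p (i + 1)) (p (n - 1)) := Q.adj_of_mem_edges he
    have hs := hsplit (i + 1) k (by omega) (by omega) (by omega)
    have hsr := congrArg List.reverse hs
    rw [← Walk.support_reverse, List.reverse_append, List.reverse_append,
      ← List.append_assoc] at hsr
    refine hP.reverse.false_of_support_eq_append (by simpa using hqP) hsr ?_ ?_ ?_ ?_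
    · simp; omega
    · have e : k + (n - k) - 1 = n - 1 := by omega
      simp [List.head?_range', List.getLast?_range', e, hadj']
    · simp [List.head?_range', hadj_k.symm]
    · have e : 1 + i - 1 = i := by omega
      simp [List.getLast?_range', e, hadj]
end

section
/- Suppose there exists a simple graph G on exactly 10 vertices with two longest paths P and Q such that |V(P) ∩ V(Q)| = 6, |V(P) \ V(Q)| = |V(Q) \ V(P)| = 2 (so V(G) = V(P) ∪ V(Q)), and the subgraph of G induced on V(G) \ (V(P) ∩ V(Q)) is connected. Then there exists a simple graph G′ with two longest paths P′ and Q′ having all of these same properties and, in addition, neither endpoint of P′ lies in V(P′) \ V(Q′) and neither endpoint of Q′ lies in V(Q′) \ V(P′). -/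
/-- The arcs of the vertex sequence `l` on `{0, …, 9}`, the arc `(i, j)` being bit `10 * i + j`. -/
def arcMask : List ℕ → ℕ
  | [] => 0
  | [_] => 0
  | a :: b :: l => 2 ^ (10 * a + b) ||| arcMask (b :: l)

/-- Both orientations of the edge between `i` and `j`. -/
def edgeMask (i j : ℕ) : ℕ := 2 ^ (10 * i + j) ||| 2 ^ (10 * j + i)

/-- Does the arc set `m` contain one of the arc sets in `F`? -/
def containsOne (F : List ℕ) (m : ℕ) : Bool := F.any fun f => Nat.beq (m &&& f) f

/-- Extend a path ending in `c` by at most `n` vertices taken from `r`, in all possible ways,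
adding its edges to `m`; each branch must meet an arc set in `F` or satisfy `k`. -/
def extendSearch (F : List ℕ) (k : ℕ → List ℕ → Bool) : ℕ → ℕ → ℕ → List ℕ → Bool
  | 0, m, _, r => containsOne F m || k m r
  | n + 1, m, c, r => containsOne F m ||
      ((r.all fun x => extendSearch F k n (m ||| edgeMask c x) x (r.erase x)) && k m r)

/-- Vertex sequences on nine vertices, one of which is a path in the union of the path
`0, …, 7`, the edge between `1` and `8`, and any path on the vertices `2, …, 9`. -/
def ninePaths : List (List ℕ) :=
  [[0, 1, 2, 3, 4, 5, 6, 7, 8], [7, 6, 5, 4, 3, 2, 1, 8, 9], [0, 1, 2, 3, 4, 5, 6, 7, 9],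
   [0, 1, 8, 2, 3, 4, 5, 6, 7], [0, 1, 8, 6, 5, 4, 3, 2, 7], [7, 6, 5, 4, 3, 8, 1, 2, 9],
   [0, 1, 2, 3, 7, 6, 5, 4, 8], [0, 1, 2, 3, 4, 7, 6, 5, 8], [7, 6, 5, 4, 8, 1, 2, 3, 9],
   [7, 6, 5, 8, 1, 2, 3, 4, 9], [0, 1, 2, 3, 4, 5, 7, 6, 8], [0, 1, 2, 7, 6, 5, 4, 3, 8],
   [0, 1, 2, 3, 4, 7, 6, 5, 9], [0, 1, 2, 3, 4, 5, 7, 6, 9], [0, 1, 8, 6, 5, 4, 3, 2, 9],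
   [0, 1, 8, 5, 4, 3, 2, 7, 6], [0, 1, 8, 3, 2, 4, 5, 6, 7], [0, 1, 8, 4, 3, 2, 7, 6, 5],
   [7, 6, 5, 2, 1, 8, 3, 4, 9], [0, 1, 2, 4, 3, 7, 6, 5, 8], [0, 1, 2, 5, 4, 3, 7, 6, 8],
   [0, 1, 8, 4, 5, 6, 3, 2, 9], [0, 1, 2, 3, 4, 9, 5, 6, 7], [0, 1, 8, 5, 6, 4, 3, 2, 9],
   [0, 1, 2, 3, 8, 4, 5, 6, 7], [7, 6, 5, 3, 4, 8, 1, 2, 9], [7, 6, 5, 8, 1, 2, 4, 3, 9],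
   [0, 1, 2, 5, 6, 7, 4, 3, 9], [0, 1, 2, 3, 4, 8, 5, 6, 7], [7, 6, 8, 1, 2, 3, 4, 5, 9],
   [0, 1, 8, 5, 4, 3, 2, 6, 7], [0, 1, 2, 6, 7, 5, 4, 3, 8], [0, 1, 8, 5, 4, 3, 2, 9, 6],
   [0, 1, 2, 5, 6, 7, 4, 3, 8], [0, 1, 8, 4, 3, 2, 9, 5, 6], [0, 1, 2, 3, 4, 5, 9, 6, 7],
   [0, 1, 8, 5, 4, 2, 3, 6, 7], [0, 1, 2, 3, 6, 7, 5, 4, 8], [0, 1, 8, 4, 3, 2, 6, 5, 7]]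

theorem extendSearch_ninePaths :
    extendSearch (ninePaths.map arcMask)
      (fun m r => bif Nat.ble r.length 3 then
        extendSearch (ninePaths.map arcMask) (fun _ r => !r.isEmpty) 3 m 8 r else true) 7
      (arcMask [0, 1, 2, 3, 4, 5, 6, 7] ||| arcMask [7, 6, 5, 4, 3, 2, 1, 0] ||| edgeMask 1 8)
      8 [2, 3, 4, 5, 6, 7, 9] = true := by
  decide +kernel

section Search

variable {A : ℕ → ℕ → Prop}

theorem edgeMask_sound {i j : ℕ} (hi : i < 10) (hj : j < 10) (h : A i j) (h' : A j i) {b : ℕ}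
    (hb : (edgeMask i j).testBit b) : A (b / 10) (b % 10) := by
  simp only [edgeMask, Nat.testBit_or, Nat.testBit_two_pow, Bool.or_eq_true,
    decide_eq_true_eq] at hb
  rcases hb with rfl | rfl
  · rwa [Nat.mul_add_div (by omega), Nat.mul_add_mod, Nat.div_eq_of_lt hj, Nat.mod_eq_of_lt hj]
  · rwa [Nat.mul_add_div (by omega), Nat.mul_add_mod, Nat.div_eq_of_lt hi, Nat.mod_eq_of_lt hi]

theorem arcMask_sound {l : List ℕ} (hl : ∀ x ∈ l, x < 10) (h : l.IsChain A) {b : ℕ}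
    (hb : (arcMask l).testBit b) : A (b / 10) (b % 10) := by
  induction l using arcMask.induct with
  | case1 => simp [arcMask] at hb
  | case2 => simp [arcMask] at hb
  | case3 i j l ih =>
    simp only [arcMask, Nat.testBit_or, Nat.testBit_two_pow, Bool.or_eq_true,
      decide_eq_true_eq] at hb
    rcases hb with rfl | hb
    · have hj : j < 10 := hl j (by simp)
      rw [Nat.mul_add_div (by omega), Nat.mul_add_mod, Nat.div_eq_of_lt hj, Nat.mod_eq_of_lt hj]
      exact h.rel
    · exact ih (fun x hx => hl x (by simp_all)) h.of_cons hb

theorem isChain_of_arcMask {l : List ℕ} (hl : ∀ x ∈ l, x < 10)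
    (h : ∀ b, (arcMask l).testBit b → A (b / 10) (b % 10)) : l.IsChain A := by
  induction l using arcMask.induct with
  | case1 => simp
  | case2 => simp
  | case3 i j l ih =>
    have hj : j < 10 := hl j (by simp)
    refine .cons_cons ?_ (ih (fun x hx => hl x (by simp_all)) fun b hb => h b ?_)
    · have := h (10 * i + j) (by simp [arcMask, Nat.testBit_or])
      rwa [Nat.mul_add_div (by omega), Nat.mul_add_mod, Nat.div_eq_of_lt hj,
        Nat.mod_eq_of_lt hj] at this
    · simp [arcMask, Nat.testBit_or, hb]

theorem not_containsOne_ninePaths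
    (hA : ∀ l : List ℕ, (∀ x ∈ l, x < 10) → l.Nodup → l.IsChain A → l.length ≠ 9) {m : ℕ}
    (hm : ∀ b, m.testBit b → A (b / 10) (b % 10)) :
    containsOne (ninePaths.map arcMask) m = false := by
  rw [Bool.eq_false_iff]
  intro h
  simp only [containsOne, List.any_map, List.any_eq_true, Function.comp_apply] at h
  obtain ⟨l, hl, hml⟩ := h
  replace hml := Nat.eq_of_beq_eq_true hml
  obtain ⟨hlt, hnd, hlen⟩ :
      (∀ x ∈ l, x < 10) ∧ l.Nodup ∧ l.length = 9 := by
    clear hml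
    revert l
    decide
  refine hA l hlt hnd (isChain_of_arcMask hlt fun b hb => hm b ?_) hlen
  rw [← hml, Nat.testBit_and, Bool.and_eq_true] at hb
  exact hb.1

/-- If `extendSearch` succeeds and no arc set in `F` occurs in `A`, then `k` holds after the
extension along any path `c, R` of `A`. -/
theorem extendSearch_sound {F : List ℕ} {k : ℕ → List ℕ → Bool} (hsymm : ∀ i j, A i j → A j i)
    (hF : ∀ m : ℕ, (∀ b, m.testBit b → A (b / 10) (b % 10)) → containsOne F m = false)
    {L : List ℕ} (R : List ℕ) {n m c : ℕ} {r : List ℕ} (hc : c < 10) (hr : ∀ x ∈ r, x < 10)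
    (hm : ∀ b, m.testBit b → A (b / 10) (b % 10)) (hR : (c :: R).IsChain A)
    (hn : R.length ≤ n) (hperm : (R ++ L).Perm r) (h : extendSearch F k n m c r = true) :
    ∃ m' r', (∀ b, m'.testBit b → A (b / 10) (b % 10)) ∧ L.Perm r' ∧ k m' r' = true := by
  induction R generalizing n m c r with
  | nil =>
    refine ⟨m, r, hm, hperm, ?_⟩
    cases n <;> simp_all [extendSearch]
  | cons x R ih =>
    obtain _ | n := n
    · simp at hn
    simp only [extendSearch, hF m hm, Bool.false_or, Bool.and_eq_true, List.all_eq_true] at h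
    have hx : x ∈ r := hperm.subset (by simp)
    have hx' := hr x hx
    refine ih hx' (fun y hy => hr y (List.mem_of_mem_erase hy)) (fun b hb => ?_) hR.of_cons
      (by simpa using hn) ?_ (h.1 x hx)
    · rw [Nat.testBit_or, Bool.or_eq_true] at hb
      exact hb.elim (hm b) (edgeMask_sound hc hx' hR.rel (hsymm _ _ hR.rel))
    · simpa using hperm.erase x

/-- If `1` is joined to `8`, a path `0, …, 7` and a path on `2, …, 9` always give rise to a path
on nine vertices. -/
theorem exists_nine_path (hsymm : ∀ i j, A i j → A j i)
    (hP : [0, 1, 2, 3, 4, 5, 6, 7].IsChain A) (h18 : A 1 8) {Q : List ℕ}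
    (hQ : Q.IsChain A) (hperm : Q.Perm [2, 3, 4, 5, 6, 7, 8, 9]) :
    ∃ l : List ℕ, (∀ x ∈ l, x < 10) ∧ l.Nodup ∧ l.IsChain A ∧ l.length = 9 := by
  by_contra! hA
  have hF := fun m => not_containsOne_ninePaths hA (m := m)
  obtain ⟨L, R, rfl⟩ := List.append_of_mem (hperm.symm.subset (by simp : 8 ∈ _))
  wlog hL : L.length ≤ 3 generalizing L R
  · have hlen := hperm.length_eq
    simp only [List.length_append, List.length_cons, List.length_nil] at hlen
    refine this R.reverse L.reverse ?_ ?_ (by simp; omega)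
    · have := List.isChain_reverse.2 (hQ.imp fun i j h => hsymm i j h)
      simpa using this
    · refine .trans ?_ hperm
      have := List.reverse_perm (L ++ 8 :: R)
      simpa using this
  have hsplit := List.isChain_append.1 hQ
  have hRL : (R ++ L).Perm [2, 3, 4, 5, 6, 7, 9] := by
    have h := (List.perm_append_comm.trans hperm).erase 8
    simpa using h
  have hlen := hRL.length_eq
  simp only [List.length_append, List.length_cons, List.length_nil] at hlen
  have hrev : [7, 6, 5, 4, 3, 2, 1, 0].IsChain A := by
    have := List.isChain_reverse.2 (hP.imp fun i j h => hsymm i j h)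
    simpa using this
  obtain ⟨m, r, hm, hr, hk⟩ := extendSearch_sound hsymm hF R (by norm_num) (by decide)
    (fun b hb => by
      simp only [Nat.testBit_or, Bool.or_eq_true] at hb
      rcases hb with (hb | hb) | hb
      · exact arcMask_sound (by decide) hP hb
      · exact arcMask_sound (by decide) hrev hb
      · exact edgeMask_sound (by norm_num) (by norm_num) h18 (hsymm _ _ h18) hb)
    hsplit.2.1 (by omega) hRL extendSearch_ninePaths
  rw [Nat.ble_eq_true_of_le (hr.length_eq ▸ hL), cond_true] at hk
  have hlt : ∀ x ∈ r, x < 10 := by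
    have : ∀ x ∈ [2, 3, 4, 5, 6, 7, 9], x < 10 := by decide
    exact fun x hx => this x (hRL.subset (by simp [hr.mem_iff, hx]))
  have hL8 : (8 :: L.reverse).IsChain A := by
    have := List.isChain_reverse.2 (hQ.imp fun i j h => hsymm i j h)
    simp only [List.reverse_append, List.reverse_cons, List.append_assoc, List.singleton_append]
      at this
    exact (List.isChain_append.1 this).2.1
  obtain ⟨m', r', -, hr', hk'⟩ := extendSearch_sound (L := []) hsymm hF L.reverse (by norm_num)
    hlt hm hL8 (by simpa using hL) (by simpa using (L.reverse_perm.trans hr)) hk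
  simp [← hr'.nil_eq] at hk'

end Search

section Paths

variable {V : Type*} {G : SimpleGraph V}

/-- No graph without paths on nine vertices has a path `p₁, p₂, c` and a path on the vertices of
`c` together with `q₁` and `q₂` such that `p₂` is joined to `q₁`. -/
theorem false_of_private_end
    (hG : ∀ l : List V, l.IsChain G.Adj → l.Nodup → l.length ≤ 8)
    {p₁ p₂ q₁ q₂ : V} {c Q : List V} (hc : c.length = 6)
    (hnd : (p₁ :: p₂ :: (c ++ [q₁, q₂])).Nodup) (hP : (p₁ :: p₂ :: c).IsChain G.Adj)
    (hQ : Q.IsChain G.Adj) (hperm : Q.Perm (c ++ [q₁, q₂])) (h : G.Adj p₂ q₁) : False := by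
  obtain ⟨c₁, c₂, c₃, c₄, c₅, c₆, rfl⟩ :
      ∃ c₁ c₂ c₃ c₄ c₅ c₆, c = [c₁, c₂, c₃, c₄, c₅, c₆] := by
    match c, hc with
    | [c₁, c₂, c₃, c₄, c₅, c₆], _ => exact ⟨c₁, c₂, c₃, c₄, c₅, c₆, rfl⟩
  set f : ℕ → V := fun i => [p₁, p₂, c₁, c₂, c₃, c₄, c₅, c₆, q₁, q₂].getD i p₁ with hf
  have hinj : ∀ i < 10, ∀ j < 10, f i = f j → i = j := by
    intro i hi j hj hij
    simp only [hf] at hij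
    rw [List.getD_eq_getElem _ _ (by simpa using hi), List.getD_eq_getElem _ _ (by simpa using hj)]
      at hij
    exact (List.Nodup.getElem_inj_iff hnd).1 hij
  have hperm' : Q.Perm ([2, 3, 4, 5, 6, 7, 8, 9].map f) := hperm
  obtain ⟨Q', rfl, hQ'⟩ := (congrFun₂ (List.eq_map_comp_perm f) _ _).mpr hperm'
  obtain ⟨l, hl, hlnd, hlc, hlen⟩ := exists_nine_path (A := fun i j => G.Adj (f i) (f j))
    (fun _ _ h => h.symm) ((List.isChain_map f).1 hP) h ((List.isChain_map f).1 hQ) hQ'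
  have := hG (l.map f) ((List.isChain_map f).2 hlc)
    (hlnd.map_on fun i hi j hj => hinj i (hl i hi) j (hl j hj))
  simp [hlen] at this

/-- A longest path on eight vertices can be rerouted through the same vertices so that it ends
in vertices of `Q`. -/
theorem exists_perm_ends_mem
    (hG : ∀ l : List V, l.IsChain G.Adj → l.Nodup → l.length ≤ 8) {P Q : List V}
    (hP : P.IsChain G.Adj) (hPnd : P.Nodup) (hPlen : P.length = 8)
    (hQ : Q.IsChain G.Adj) (hQnd : Q.Nodup)
    (hPQ : ({x | x ∈ P} \ {x | x ∈ Q}).ncard = 2) (hQP : ({x | x ∈ Q} \ {x | x ∈ P}).ncard = 2)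
    (hcover : ∀ x, x ∈ P ∨ x ∈ Q)
    (hcut : ∀ T : Set V, (∃ x ∈ T, ¬(x ∈ P ∧ x ∈ Q)) → (∃ x ∉ T, ¬(x ∈ P ∧ x ∈ Q)) →
      ∃ x ∈ T, ∃ y ∉ T, ¬(x ∈ P ∧ x ∈ Q) ∧ ¬(y ∈ P ∧ y ∈ Q) ∧ G.Adj x y) :
    ∃ P' : List V, P'.Perm P ∧ P'.IsChain G.Adj ∧ (∀ x ∈ P'.head?, x ∈ Q) ∧
      ∀ x ∈ P'.getLast?, x ∈ Q := by
  have key : ∀ a t, (a :: t).Perm P → (a :: t).IsChain G.Adj → a ∉ Q →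
      ∃ P' : List V, P'.Perm P ∧ P'.IsChain G.Adj ∧ (∀ x ∈ P'.head?, x ∈ Q) ∧
        ∀ x ∈ P'.getLast?, x ∈ Q := by
    intro a t hperm hchain ha
    have hnd := hperm.nodup_iff.2 hPnd
    have hend : ∀ l : List V, l.Perm P → l.IsChain G.Adj → ∀ x ∈ l.head?, ∀ y ∉ P,
        ¬ G.Adj x y := by
      intro l hl hlc x hx y hy hxy
      have := hG (y :: l) (hlc.cons (by intro z hz; cases hx.symm.trans hz; exact hxy.symm))
        (List.nodup_cons.2 ⟨fun h => hy (hl.subset h), hl.nodup_iff.2 hPnd⟩)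
      simp [hl.length_eq, hPlen] at this
    have haP : a ∈ P := hperm.subset (by simp)
    obtain ⟨p, hap, hpriv⟩ : ∃ p, a ≠ p ∧ ∀ x, x ∈ P ∧ x ∉ Q ↔ x = a ∨ x = p := by
      obtain ⟨x, y, hxy, h⟩ := Set.ncard_eq_two.1 hPQ
      have h' : ∀ z, z ∈ P ∧ z ∉ Q ↔ z = x ∨ z = y := fun z => by
        simpa using Set.ext_iff.1 h z
      rcases (h' a).1 ⟨haP, ha⟩ with rfl | rfl
      · exact ⟨y, hxy, h'⟩
      · exact ⟨x, hxy.symm, fun z => (h' z).trans or_comm⟩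
    obtain ⟨q, q', hqq, hq⟩ := Set.ncard_eq_two.1 hQP
    replace hq : ∀ z, z ∈ Q ∧ z ∉ P ↔ z = q ∨ z = q' := fun z => by
      simpa using Set.ext_iff.1 hq z
    have hpP := (hpriv p).2 (.inr rfl)
    have hqP := (hq q).2 (.inl rfl)
    have hap' : G.Adj a p := by
      obtain ⟨x, rfl, y, hy, -, hyS, hxy⟩ := hcut {a} ⟨a, rfl, fun h => ha h.2⟩
        ⟨p, fun h => hap h.symm, fun h => hpP.2 h.2⟩
      have hyP : y ∈ P := by
        by_contra hyP
        exact hend _ hperm hchain _ rfl y hyP hxy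
      rcases (hpriv y).1 ⟨hyP, fun h => hyS ⟨hyP, h⟩⟩ with h | rfl
      · exact absurd h hy
      · exact hxy
    obtain ⟨s, hsQ, hsP, hps⟩ : ∃ s, s ∈ Q ∧ s ∉ P ∧ G.Adj p s := by
      obtain ⟨x, hx, y, hy, -, hyS, hxy⟩ := hcut {a, p} ⟨a, by simp, fun h => ha h.2⟩
        ⟨q, fun h => hqP.2 (by rcases h with rfl | rfl <;> simp_all), fun h => hqP.2 h.1⟩
      have hyP : y ∉ P := fun hyP => hy ((hpriv y).1 ⟨hyP, fun h => hyS ⟨hyP, h⟩⟩)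
      rcases hx with rfl | rfl
      · exact absurd hxy (hend _ hperm hchain _ rfl y hyP)
      · exact ⟨y, (hcover y).resolve_left hyP, hyP, hxy⟩
    obtain ⟨s', hss, hs⟩ : ∃ s', s ≠ s' ∧ ∀ z, z ∈ Q ∧ z ∉ P ↔ z = s ∨ z = s' := by
      rcases (hq s).1 ⟨hsQ, hsP⟩ with rfl | rfl
      · exact ⟨q', hqq, hq⟩
      · exact ⟨q, hqq.symm, fun z => (hq z).trans or_comm⟩
    have hs'P := (hs s').2 (.inr rfl)
    obtain ⟨A, B, rfl⟩ := List.append_of_mem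
      (((List.mem_cons.1 (hperm.symm.subset hpP.1)).resolve_left (Ne.symm hap)))
    have hmem : ∀ x, x ∈ A ∨ x ∈ B → x ∈ Q := by
      intro x hx
      by_contra hxQ
      have := (hpriv x).1 ⟨hperm.subset (by simp; tauto), hxQ⟩
      grind
    rcases List.eq_nil_or_concat A with rfl | ⟨A, x, rfl⟩
    · have hlen := hperm.length_eq
      have hB : ∀ x, x ∈ P ↔ x = a ∨ x = p ∨ x ∈ B := fun x => by simp [← hperm.mem_iff]
      refine (false_of_private_end hG (q₁ := s) (q₂ := s') (by simp [hPlen] at hlen; omega)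
        ?_ hchain hQ ?_ hps).elim
      · have := List.nodup_append.2 ⟨hnd, (by simpa using hss : [s, s'].Nodup), ?_⟩
        · simpa using this
        · intro y hy z hz hyz
          have := hperm.subset hy
          grind
      · refine (List.perm_ext_iff_of_nodup hQnd ?_).2 fun y => ?_
        · refine List.nodup_append.2 ⟨by simp_all, by simpa using hss, ?_⟩
          grind
        · have := hmem y
          have := hB y
          have := hs y
          have := hpP.2
          simp only [List.mem_append, List.mem_cons, List.not_mem_nil, or_false]
          grind
    · refine ⟨(a :: (A ++ [x])).reverse ++ p :: B, ?_, ?_, ?_, ?_⟩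
      · refine .trans ?_ hperm
        simpa using (List.reverse_perm (a :: (A ++ [x]))).append_right (p :: B)
      · have h : (a :: (A ++ [x]) ++ p :: B).IsChain G.Adj := by simpa using hchain
        replace h := List.isChain_append.1 h
        refine List.isChain_append.2
          ⟨List.isChain_reverse.2 (h.1.imp fun _ _ h => h.symm), h.2.1, ?_⟩
        simpa [List.getLast?_cons] using hap'
      · simpa using hmem x (by simp)
      · intro y hy
        rcases List.eq_nil_or_concat B with rfl | ⟨B, z, rfl⟩
        · refine absurd hps (hend _ ((List.reverse_perm _).trans hperm)
            (List.isChain_reverse.2 (hchain.imp fun _ _ h => h.symm)) _ ?_ s hsP)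
          simp
        · refine hmem y (.inr ?_)
          rw [List.concat_eq_append, List.getLast?_append_of_ne_nil _ (List.cons_ne_nil _ _),
            ← List.cons_append, List.getLast?_concat, Option.mem_some_iff] at hy
          simp [hy]
  by_cases hhead : ∀ x ∈ P.head?, x ∈ Q
  · by_cases hlast : ∀ x ∈ P.getLast?, x ∈ Q
    · exact ⟨P, .refl _, hP, hhead, hlast⟩
    · push Not at hlast
      obtain ⟨x, hx, hxQ⟩ := hlast
      obtain ⟨t, rfl⟩ := List.getLast?_eq_some_iff.1 hx
      refine key x t.reverse ?_ ?_ hxQ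
      · simpa using List.reverse_perm (t ++ [x])
      · simpa using List.isChain_reverse.2 (hP.imp fun _ _ h => h.symm)
  · push Not at hhead
    obtain ⟨x, hx, hxQ⟩ := hhead
    obtain ⟨t, rfl⟩ := List.head?_eq_some_iff.1 hx
    exact key x t (.refl _) hP hxQ

end Paths


open SimpleGraph

/-- if there is a simple graph on exactly 10 vertices with longest paths
`P`, `Q` such that `|V(P) ∩ V(Q)| = 6`, `|V(P) \ V(Q)| = |V(Q) \ V(P)| = 2` and the
subgraph induced on the complement of `V(P) ∩ V(Q)` is connected, then there is such a
graph `G'` with longest paths `P'`, `Q'` having the same properties and in addition no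
endpoint of `P'` lies in `V(P') \ V(Q')` and no endpoint of `Q'` lies in
`V(Q') \ V(P')`. -/
theorem statement16 {V : Type*} [Fintype V] (G : SimpleGraph V)
    (hcard : Fintype.card V = 10)
    {u₁ v₁ u₂ v₂ : V} (P : G.Walk u₁ v₁) (Q : G.Walk u₂ v₂)
    (hP : IsLongestPath G P) (hQ : IsLongestPath G Q)
    (hint : ({x | x ∈ P.support} ∩ {x | x ∈ Q.support}).ncard = 6)
    (hPQ : ({x | x ∈ P.support} \ {x | x ∈ Q.support}).ncard = 2)
    (hQP : ({x | x ∈ Q.support} \ {x | x ∈ P.support}).ncard = 2)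
    (hconn : (G.induce ({x | x ∈ P.support} ∩ {x | x ∈ Q.support})ᶜ).Connected) :
    ∃ (V' : Type) (_ : Fintype V') (G' : SimpleGraph V') (a b c d : V')
      (P' : G'.Walk a b) (Q' : G'.Walk c d),
      Fintype.card V' = 10 ∧
      IsLongestPath G' P' ∧ IsLongestPath G' Q' ∧
      ({x | x ∈ P'.support} ∩ {x | x ∈ Q'.support}).ncard = 6 ∧
      ({x | x ∈ P'.support} \ {x | x ∈ Q'.support}).ncard = 2 ∧
      ({x | x ∈ Q'.support} \ {x | x ∈ P'.support}).ncard = 2 ∧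
      (G'.induce ({x | x ∈ P'.support} ∩ {x | x ∈ Q'.support})ᶜ).Connected ∧
      a ∉ {x | x ∈ P'.support} \ {x | x ∈ Q'.support} ∧
      b ∉ {x | x ∈ P'.support} \ {x | x ∈ Q'.support} ∧
      c ∉ {x | x ∈ Q'.support} \ {x | x ∈ P'.support} ∧
      d ∉ {x | x ∈ Q'.support} \ {x | x ∈ P'.support} := by
  classical
  have hmax : ∀ l : List V, l.IsChain G.Adj → l.Nodup → l.length ≤ P.length + 1 := by
    intro l hl hnd
    rcases eq_or_ne l [] with rfl | hne
    · simp
    · have := hP.2 (Walk.ofSupport l hne hl) (by rwa [Walk.isPath_def, Walk.support_ofSupport])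
      rw [Walk.length_ofSupport] at this
      omega
  have hlen : ∀ {u v : V} (R : G.Walk u v), R.IsPath →
      {x | x ∈ R.support}.ncard = R.length + 1 := by
    intro u v R hR
    rw [← R.length_support, ← List.toFinset_card_of_nodup hR.support_nodup,
      ← Set.ncard_coe_finset]
    simp
  have hPlen : P.length = 7 := by
    have := Set.ncard_inter_add_ncard_sdiff_eq_ncard {x | x ∈ P.support} {x | x ∈ Q.support}
    rw [hint, hPQ, hlen P hP.1] at this
    omega
  have hQlen : Q.length = 7 := by
    have := hP.2 Q hQ.1
    have := hQ.2 P hP.1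
    omega
  have hcover : ∀ x, x ∈ P.support ∨ x ∈ Q.support := by
    have : {x | x ∈ P.support} ∪ {x | x ∈ Q.support} = Set.univ := by
      have := Set.ncard_union_add_ncard_inter {x | x ∈ P.support} {x | x ∈ Q.support}
      rw [hint, hlen P hP.1, hlen Q hQ.1] at this
      refine Set.eq_of_subset_of_ncard_le (Set.subset_univ _) ?_
      rw [Set.ncard_univ, Nat.card_eq_fintype_card]
      omega
    exact fun x => Set.eq_univ_iff_forall.1 this x
  have hcut : ∀ T : Set V, (∃ x ∈ T, ¬(x ∈ P.support ∧ x ∈ Q.support)) →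
      (∃ x ∉ T, ¬(x ∈ P.support ∧ x ∈ Q.support)) →
      ∃ x ∈ T, ∃ y ∉ T, ¬(x ∈ P.support ∧ x ∈ Q.support) ∧
        ¬(y ∈ P.support ∧ y ∈ Q.support) ∧ G.Adj x y := by
    rintro T ⟨x, hxT, hx⟩ ⟨y, hyT, hy⟩
    obtain ⟨W⟩ := hconn.preconnected ⟨x, hx⟩ ⟨y, hy⟩
    obtain ⟨d, -, hd₁, hd₂⟩ := W.exists_boundary_dart (Subtype.val ⁻¹' T) hxT hyT
    exact ⟨d.fst, hd₁, d.snd, hd₂, d.fst.2, d.snd.2, d.adj⟩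
  rw [hPlen] at hmax
  obtain ⟨P₁, hP₁, hP₁c, hP₁h, hP₁l⟩ := exists_perm_ends_mem hmax P.isChain_adj_support
    hP.1.support_nodup (by simp [hPlen]) Q.isChain_adj_support hQ.1.support_nodup hPQ hQP
    hcover hcut
  obtain ⟨Q₁, hQ₁, hQ₁c, hQ₁h, hQ₁l⟩ := exists_perm_ends_mem hmax Q.isChain_adj_support
    hQ.1.support_nodup (by simp [hQlen]) P.isChain_adj_support hP.1.support_nodup hQP hPQ
    (fun x => (hcover x).symm) (by simpa only [and_comm] using hcut)
  have hP₁ne : P₁ ≠ [] := by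
    rintro rfl
    simpa using hP₁.length_eq
  have hQ₁ne : Q₁ ≠ [] := by
    rintro rfl
    simpa using hQ₁.length_eq
  let φ := G.overFinIso hcard
  let P' := (Walk.ofSupport P₁ hP₁ne hP₁c).map φ.toHom
  let Q' := (Walk.ofSupport Q₁ hQ₁ne hQ₁c).map φ.toHom
  have hP's : {x | x ∈ P'.support} = φ '' {x | x ∈ P.support} := by
    ext x
    simp [P', Walk.support_ofSupport, hP₁.mem_iff]
  have hQ's : {x | x ∈ Q'.support} = φ '' {x | x ∈ Q.support} := by
    ext x
    simp [Q', Walk.support_ofSupport, hQ₁.mem_iff]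
  have hlongest : ∀ {a b : Fin 10} (R : (G.overFin hcard).Walk a b), R.IsPath → R.length ≤ 7 := by
    intro a b R hR
    have := hmax (R.map φ.symm.toHom).support (Walk.isChain_adj_support _)
      (Walk.IsPath.map φ.symm.injective hR).support_nodup
    rwa [Walk.length_support, Walk.length_map, Nat.add_le_add_iff_right (n := 1)] at this
  have hP'l : P'.length = 7 := by
    simp [P', Walk.length_ofSupport, hP₁.length_eq, hPlen]
  have hQ'l : Q'.length = 7 := by
    simp [Q', Walk.length_ofSupport, hQ₁.length_eq, hQlen]
  refine ⟨Fin 10, inferInstance, G.overFin hcard, _, _, _, _, P', Q', by simp,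
    ⟨?_, fun R hR => hP'l ▸ hlongest R hR⟩, ⟨?_, fun R hR => hQ'l ▸ hlongest R hR⟩, ?_⟩
  · refine Walk.IsPath.map φ.injective ?_
    rw [Walk.isPath_def, Walk.support_ofSupport]
    exact hP₁.nodup_iff.2 hP.1.support_nodup
  · refine Walk.IsPath.map φ.injective ?_
    rw [Walk.isPath_def, Walk.support_ofSupport]
    exact hQ₁.nodup_iff.2 hQ.1.support_nodup
  rw [hP's, hQ's, ← Set.image_inter φ.injective, ← Set.image_sdiff φ.injective,
    ← Set.image_sdiff φ.injective, Set.ncard_image_of_injective _ φ.injective,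
    Set.ncard_image_of_injective _ φ.injective, Set.ncard_image_of_injective _ φ.injective,
    ← Set.image_compl_eq φ.bijective]
  have hmem : ∀ {s t : Set V} {x : V}, x ∈ t → φ x ∉ φ '' (s \ t) := by
    rintro s t x hx ⟨y, hy, hyx⟩
    exact hy.2 (φ.injective hyx ▸ hx)
  exact ⟨hint, hPQ, hQP, (φ.induce φ.injective.injOn.bijOn_image).connected_iff.1 hconn,
    hmem (hP₁h _ (List.head_mem_head? hP₁ne)), hmem (hP₁l _ (List.getLast_mem_getLast? hP₁ne)),
    hmem (hQ₁h _ (List.head_mem_head? hQ₁ne)), hmem (hQ₁l _ (List.getLast_mem_getLast? hQ₁ne))⟩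
end
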